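/- Let E be a real inner product space, let N ≥ 2 and B ≥ 1 be natural numbers, let n be a fixed anchor model index in {1,…,N}, let z^m_b ∈ E be representation vectors for each model m ∈ {1,…,N} and batch index b ∈ {1,…,B}, let τ_m > 0 be a temperature for each m ≠ n, and let i ∈ {1,…,B} be a fixed batch index. Then the Muscle loss with all weighting coefficients equal to 1 equals the sum of the pairwise InfoNCE losses: −log( exp(Σ_{m≠n} ⟨z^n_i, z^m_i⟩/τ_m) / Σ_{j∈J} exp(Σ_{m≠n} ⟨z^n_i, z^m_{j_m}⟩/τ_m) ) = Σ_{m≠n} [ −log( exp(⟨z^n_i, z^m_i⟩/τ_m) / Σ_{b=1}^{B} exp(⟨z^n_i, z^m_b⟩/τ_m) ) ], where J is the set of all tuples j = (j_m)_{m≠n} with each j_m ∈ {1,…,B}. -/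

import Mathlib

open Real RealInnerProductSpace

/-- The Muscle loss with all weighting coefficients equal to 1 equals the sum of the
pairwise InfoNCE losses. -/
theorem muscle_loss_unit_weights_eq_sum_infoNCE
    {E : Type*} [NormedAddCommGroup E] [InnerProductSpace ℝ E]
    (N B : ℕ) (hN : 2 ≤ N) (hB : 1 ≤ B)
    (n : Fin N) (z : Fin N → Fin B → E)
    (τ : Fin N → ℝ) (hτ : ∀ m : Fin N, m ≠ n → 0 < τ m)
    (i : Fin B) :
    -Real.log
        (Real.exp (∑ m : {m : Fin N // m ≠ n}, ⟪z n i, z m.1 i⟫ / τ m.1) /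
          ∑ j : {m : Fin N // m ≠ n} → Fin B,
            Real.exp (∑ m : {m : Fin N // m ≠ n}, ⟪z n i, z m.1 (j m)⟫ / τ m.1)) =
      ∑ m : {m : Fin N // m ≠ n},
        -Real.log
          (Real.exp (⟪z n i, z m.1 i⟫ / τ m.1) /
            ∑ b : Fin B, Real.exp (⟪z n i, z m.1 b⟫ / τ m.1)) := by
  have sum_exp_ne_zero (m : {m : Fin N // m ≠ n}) :
      ∑ b : Fin B, Real.exp (⟪z n i, z m.1 b⟫ / τ m.1) ≠ 0 :=
    (Finset.sum_pos (fun _ _ => Real.exp_pos _) ⟨i, Finset.mem_univ i⟩).ne'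
  simp_rw [Real.exp_sum]
  rw [← Fintype.prod_sum (fun (m : {m : Fin N // m ≠ n}) (b : Fin B) =>
      Real.exp (⟪z n i, z m.1 b⟫ / τ m.1)),
    ← Finset.prod_div_distrib,
    Real.log_prod fun m _ => div_ne_zero (Real.exp_ne_zero _) (sum_exp_ne_zero m),
    Finset.sum_neg_distrib]
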